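/- For every Schwartz function F ∈ 𝒮(ℝ^{2d};ℂ), the frame expansion converges in the Schwartz topology: the family (c_{α̃,β̃}(F) · G_{α̃,β̃})_{α̃,β̃∈ℤ^d×ℤ^d} is summable in 𝒮(ℝ^{2d};ℂ) and its sum equals F. -/

import Mathlib

open MeasureTheory Filter
open scoped ENNReal

noncomputable section

/-- Japanese bracket `⟨v⟩ = √(1+‖v‖²)` with the Euclidean norm on `ℝ^N`. -/
def jbV {N : ℕ} (v : Fin N → ℝ) : ℝ := Real.sqrt (1 + ∑ i, v i ^ 2)

/-- A tempered weight on `ℝ^N`: a positive function `m` with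
`m(u+v) ≤ C·m(u)·⟨v⟩^a` for some `C, a > 0`. -/
def IsTemperedWeight {N : ℕ} (m : (Fin N → ℝ) → ℝ) : Prop :=
  (∀ u, 0 < m u) ∧ ∃ C > 0, ∃ a : ℝ, 0 < a ∧ ∀ u v, m (u + v) ≤ C * m u * jbV v ^ a

/-- A regular magnetic field on `ℝ^d`: smooth, antisymmetric, closed, with all
derivatives of all components bounded. -/
structure IsRegularMagneticField (d : ℕ) (B : Fin d → Fin d → (Fin d → ℝ) → ℝ) : Prop where
  smooth : ∀ j k, ContDiff ℝ (⊤ : ℕ∞) (B j k)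
  antisymm : ∀ j k x, B j k x = - B k j x
  closed : ∀ i j k, ∀ x : Fin d → ℝ,
      fderiv ℝ (B j k) x (Pi.single i 1) + fderiv ℝ (B k i) x (Pi.single j 1)
        + fderiv ℝ (B i j) x (Pi.single k 1) = 0
  derivBounded : ∀ j k, ∀ n : ℕ, ∃ C : ℝ, ∀ x, ‖iteratedFDeriv ℝ n (B j k) x‖ ≤ C

/-- The transversal-gauge vector potential based at `y`:
`A_k(x;y) = Σ_j ∫₀¹ s·(x_j−y_j)·B_{jk}(y+s(x−y)) ds`. -/
def magA (d : ℕ) (B : Fin d → Fin d → (Fin d → ℝ) → ℝ) (y x : Fin d → ℝ) (k : Fin d) : ℝ :=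
  ∑ j, ∫ s in (0:ℝ)..1, s * (x j - y j) * B j k (y + s • (x - y))

/-- The circulation `φ(x,y) = Σ_k ∫₀¹ A_k(y+s(x−y))·(x_k−y_k) ds` of `A = A(·;0)`
along the segment from `y` to `x`. -/
def magPhi (d : ℕ) (B : Fin d → Fin d → (Fin d → ℝ) → ℝ) (x y : Fin d → ℝ) : ℝ :=
  ∑ k, ∫ s in (0:ℝ)..1, magA d B 0 (y + s • (x - y)) k * (x k - y k)

/-- A window function for the magnetic Gabor frame: smooth, compactly supported in
`(−1,1)^d`, with `Σ_{α∈ℤ^d} 𝔤(x−α)² = 1`. -/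
structure IsWindow (d : ℕ) (g : (Fin d → ℝ) → ℝ) : Prop where
  smooth : ContDiff ℝ (⊤ : ℕ∞) g
  compactSupport : HasCompactSupport g
  support_subset : ∀ x : Fin d → ℝ, g x ≠ 0 → ∀ i, |x i| < 1
  partition : ∀ x : Fin d → ℝ, ∑' α : Fin d → ℤ, (g (x - fun i => (α i : ℝ))) ^ 2 = 1

abbrev Idx (d : ℕ) := (Fin d → ℤ) × (Fin d → ℤ)
abbrev Idx2 (d : ℕ) := Idx d × Idx d
abbrev E1 (d : ℕ) := Fin d → ℝ
abbrev E2 (d : ℕ) := E1 d × E1 d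
abbrev E4 (d : ℕ) := E2 d × E2 d

/-- The magnetic Gabor function
`𝒢_α̃(x) = (2π)^{−d/2}·e^{iφ(x,α)}·𝔤(x−α)·e^{iα'·(x−α)}` for `α̃ = (α,α')`. -/
def gabor (d : ℕ) (B : Fin d → Fin d → E1 d → ℝ) (g : E1 d → ℝ) (a : Idx d) (x : E1 d) : ℂ :=
  (((2 * Real.pi) ^ (-(d : ℝ) / 2) : ℝ) : ℂ) *
    Complex.exp (Complex.I * (magPhi d B x (fun i => (a.1 i : ℝ)) : ℂ)) *
    ((g (x - fun i => (a.1 i : ℝ)) : ℝ) : ℂ) *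
    Complex.exp (Complex.I * ((∑ i, (a.2 i : ℝ) * (x i - (a.1 i : ℝ)) : ℝ) : ℂ))

/-- `G_{α̃,β̃}(x,y) = 𝒢_α̃(x)·conj(𝒢_β̃(y))`. -/
def gaborTensor (d : ℕ) (B : Fin d → Fin d → E1 d → ℝ) (g : E1 d → ℝ) (a b : Idx d)
    (p : E2 d) : ℂ :=
  gabor d B g a p.1 * (starRingEnd ℂ) (gabor d B g b p.2)

/-- `T_{α̃,β̃}(x,y) = conj(𝒢_α̃(x))·𝒢_β̃(y)`. -/
def gaborDual (d : ℕ) (B : Fin d → Fin d → E1 d → ℝ) (g : E1 d → ℝ) (a b : Idx d)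
    (p : E2 d) : ℂ :=
  (starRingEnd ℂ) (gabor d B g a p.1) * gabor d B g b p.2

/-- The frame coefficient `c_{α̃,β̃}(F) = ∫ F(x,y)·conj(𝒢_α̃(x))·𝒢_β̃(y) dx dy`. -/
def frameCoef (d : ℕ) (B : Fin d → Fin d → E1 d → ℝ) (g : E1 d → ℝ) (a b : Idx d)
    (F : E2 d → ℂ) : ℂ :=
  ∫ p : E2 d, F p * (starRingEnd ℂ) (gabor d B g a p.1) * gabor d B g b p.2

/-- `⟨(α̃,β̃)⟩` with `(α̃,β̃)` regarded as a point of `ℝ^{4d}`. -/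
def jbIdxPair (d : ℕ) (a b : Idx d) : ℝ :=
  Real.sqrt (1 + (∑ i, ((a.1 i : ℝ)) ^ 2) + (∑ i, ((a.2 i : ℝ)) ^ 2)
    + (∑ i, ((b.1 i : ℝ)) ^ 2) + ∑ i, ((b.2 i : ℝ)) ^ 2)

/-- Euclidean Japanese bracket on `ℝ^{4d} = E4 d`. -/
def jbE4 (d : ℕ) (v : E4 d) : ℝ :=
  Real.sqrt (1 + (∑ i, v.1.1 i ^ 2) + (∑ i, v.1.2 i ^ 2) + (∑ i, v.2.1 i ^ 2) + ∑ i, v.2.2 i ^ 2)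

/-- A tempered weight on `ℝ^{4d}`. -/
def IsTemperedWeightE4 (d : ℕ) (M : E4 d → ℝ) : Prop :=
  (∀ u, 0 < M u) ∧ ∃ C > 0, ∃ a : ℝ, 0 < a ∧ ∀ u v, M (u + v) ≤ C * M u * jbE4 d v ^ a

/-- Euclidean Japanese bracket on `ℝ^N × ℝ^N`. -/
def jbP {N : ℕ} (v : (Fin N → ℝ) × (Fin N → ℝ)) : ℝ :=
  Real.sqrt (1 + (∑ i, v.1 i ^ 2) + ∑ i, v.2 i ^ 2)

/-- A tempered weight on `ℝ^N × ℝ^N ≅ ℝ^{2N}`. -/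
def IsTemperedWeightProd {N : ℕ} (m : (Fin N → ℝ) × (Fin N → ℝ) → ℝ) : Prop :=
  (∀ u, 0 < m u) ∧ ∃ C > 0, ∃ a : ℝ, 0 < a ∧ ∀ u v, m (u + v) ≤ C * m u * jbP v ^ a

/-- `⟨(α̃,β̃) − (γ̃,δ̃)⟩` for pairs of indices in `ℤ^{2d} × ℤ^{2d}`. -/
def jbDiffIdx2 (d : ℕ) (p q : Idx2 d) : ℝ :=
  Real.sqrt (1 + (∑ i, ((p.1.1 i - q.1.1 i : ℤ) : ℝ) ^ 2) + (∑ i, ((p.1.2 i - q.1.2 i : ℤ) : ℝ) ^ 2)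
    + (∑ i, ((p.2.1 i - q.2.1 i : ℤ) : ℝ) ^ 2) + ∑ i, ((p.2.2 i - q.2.2 i : ℤ) : ℝ) ^ 2)

/-- The midpoint `((α̃,β̃)+(γ̃,δ̃))/2 ∈ ℝ^{4d}`. -/
def midIdx2 (d : ℕ) (p q : Idx2 d) : E4 d :=
  ((fun i => ((p.1.1 i + q.1.1 i : ℤ) : ℝ) / 2, fun i => ((p.1.2 i + q.1.2 i : ℤ) : ℝ) / 2),
   (fun i => ((p.2.1 i + q.2.1 i : ℤ) : ℝ) / 2, fun i => ((p.2.2 i + q.2.2 i : ℤ) : ℝ) / 2))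

/-- Membership in the Hörmander class `S₀(M)` on `ℝ^{4d}`: smooth, with all
derivatives dominated by `M`. -/
def InS0 (d : ℕ) (M : E4 d → ℝ) (Φ : E4 d → ℂ) : Prop :=
  ContDiff ℝ (⊤ : ℕ∞) Φ ∧ ∀ n : ℕ, ∃ C : ℝ, ∀ X, ‖iteratedFDeriv ℝ n Φ X‖ ≤ C * M X

/-- The seminorms `‖Φ‖_{S₀(M),k}`. -/
def s0Seminorm (d : ℕ) (M : E4 d → ℝ) (k : ℕ) (Φ : E4 d → ℂ) : ℝ :=
  ∑ n ∈ Finset.range (k + 1), ⨆ X : E4 d, ‖iteratedFDeriv ℝ n Φ X‖ / M X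

/-- The integrand of the inner (oscillatory) integral defining `H_{(α̃,β̃),(γ̃,δ̃)}`,
evaluated at `X = ((v_L,ξ_L),(v_R,ξ_R))` and `z = (z_L,z_R)`. -/
def gaborKernel4 (d : ℕ) (B : Fin d → Fin d → E1 d → ℝ) (g : E1 d → ℝ) (ab gd : Idx2 d)
    (X : E4 d) (z : E2 d) : ℂ :=
  Complex.exp (Complex.I * (((∑ i, X.1.2 i * z.1 i) - ∑ i, X.2.2 i * z.2 i : ℝ) : ℂ)) *
  Complex.exp (Complex.I * ((magPhi d B (X.1.1 + (2 : ℝ)⁻¹ • z.1) (X.1.1 - (2 : ℝ)⁻¹ • z.1)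
      - magPhi d B (X.2.1 + (2 : ℝ)⁻¹ • z.2) (X.2.1 - (2 : ℝ)⁻¹ • z.2) : ℝ) : ℂ)) *
  gabor d B g gd.1 (X.1.1 + (2 : ℝ)⁻¹ • z.1) *
  (starRingEnd ℂ) (gabor d B g gd.2 (X.2.1 + (2 : ℝ)⁻¹ • z.2)) *
  (starRingEnd ℂ) (gabor d B g ab.1 (X.1.1 - (2 : ℝ)⁻¹ • z.1)) *
  gabor d B g ab.2 (X.2.1 - (2 : ℝ)⁻¹ • z.2)

/-- The kernel `H_{(α̃,β̃),(γ̃,δ̃)}` on `ℝ^{4d}`. -/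
def matH (d : ℕ) (B : Fin d → Fin d → E1 d → ℝ) (g : E1 d → ℝ) (ab gd : Idx2 d)
    (X : E4 d) : ℂ :=
  (((2 * Real.pi) ^ (-(2 * (d : ℝ))) : ℝ) : ℂ) * ∫ z : E2 d, gaborKernel4 d B g ab gd X z

/-- The matrix element `𝕄_{(α̃,β̃),(γ̃,δ̃)}[Φ] = ∫ Φ·H_{(α̃,β̃),(γ̃,δ̃)}`. -/
def matElem (d : ℕ) (B : Fin d → Fin d → E1 d → ℝ) (g : E1 d → ℝ) (Φ : E4 d → ℂ)
    (ab gd : Idx2 d) : ℂ :=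
  ∫ X : E4 d, Φ X * matH d B g ab gd X

/-- The dequantized frame symbol
`g_{α̃,γ̃}(v,ξ) = ∫ e^{−iξ·z}·e^{−iφ(v+z/2,v−z/2)}·𝒢_α̃(v+z/2)·conj(𝒢_γ̃(v−z/2)) dz`. -/
def deqSymbol (d : ℕ) (B : Fin d → Fin d → E1 d → ℝ) (g : E1 d → ℝ) (ac : Idx d × Idx d)
    (vξ : E2 d) : ℂ :=
  ∫ z : E1 d,
    Complex.exp (-Complex.I * ((∑ i, vξ.2 i * z i : ℝ) : ℂ)) *
    Complex.exp (-Complex.I * ((magPhi d B (vξ.1 + (2 : ℝ)⁻¹ • z) (vξ.1 - (2 : ℝ)⁻¹ • z) : ℝ) : ℂ)) *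
    gabor d B g ac.1 (vξ.1 + (2 : ℝ)⁻¹ • z) *
    (starRingEnd ℂ) (gabor d B g ac.2 (vξ.1 - (2 : ℝ)⁻¹ • z))

lemma one_add_norm_prodMk_le_of_mem_uIoc {E : Type*} [NormedAddCommGroup E] {s : ℝ}
    (hs : s ∈ Set.uIoc (0 : ℝ) 1) (x : E) :
    1 + ‖((s, x) : ℝ × E)‖ ≤ 2 * (1 + ‖x‖) := by
  rw [Set.uIoc_of_le zero_le_one] at hs
  have : ‖s‖ ≤ 1 := by rw [Real.norm_of_nonneg hs.1.le]; exact hs.2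
  have h2 : ‖((s, x) : ℝ × E)‖ ≤ 1 + ‖x‖ := by
    rw [Prod.norm_mk]; exact max_le (by linarith [norm_nonneg x]) (by linarith)
  linarith [norm_nonneg x]

section TemperateGrowth

variable {E F G : Type} [NormedAddCommGroup E] [NormedSpace ℝ E]
  [NormedAddCommGroup F] [NormedSpace ℝ F] [NormedAddCommGroup G] [NormedSpace ℝ G]

lemma Function.HasTemperateGrowth.clm_comp {f : E → F} (hf : f.HasTemperateGrowth) (L : F →L[ℝ] G) :
    (fun x => L (f x)).HasTemperateGrowth :=
  L.hasTemperateGrowth.comp hf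

lemma Function.HasTemperateGrowth.fst {f : E → F × G} (hf : f.HasTemperateGrowth) :
    (fun x => (f x).1).HasTemperateGrowth :=
  hf.clm_comp (ContinuousLinearMap.fst ℝ F G)

lemma Function.HasTemperateGrowth.snd {f : E → F × G} (hf : f.HasTemperateGrowth) :
    (fun x => (f x).2).HasTemperateGrowth :=
  hf.clm_comp (ContinuousLinearMap.snd ℝ F G)

lemma Function.HasTemperateGrowth.apply {ι : Type} [Fintype ι] {f : E → ι → ℝ}
    (hf : f.HasTemperateGrowth) (i : ι) : (fun x => f x i).HasTemperateGrowth :=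
  hf.clm_comp (ContinuousLinearMap.proj (R := ℝ) (φ := fun _ : ι => ℝ) i)

lemma Function.HasTemperateGrowth.prodMk {f : E → F} {g : E → G} (hf : f.HasTemperateGrowth)
    (hg : g.HasTemperateGrowth) : (fun x => (f x, g x)).HasTemperateGrowth := by
  have := (hf.clm_comp (ContinuousLinearMap.inl ℝ F G)).add
    (hg.clm_comp (ContinuousLinearMap.inr ℝ F G))
  convert this using 1
  ext x <;> simp

lemma Function.HasTemperateGrowth.ofReal {f : E → ℝ} (hf : f.HasTemperateGrowth) :
    (fun x => (f x : ℂ)).HasTemperateGrowth :=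
  hf.clm_comp Complex.ofRealCLM

lemma Function.HasTemperateGrowth.conj {f : E → ℂ} (hf : f.HasTemperateGrowth) :
    (fun x => (starRingEnd ℂ) (f x)).HasTemperateGrowth :=
  hf.clm_comp (Complex.conjCLE : ℂ →L[ℝ] ℂ)

lemma Complex.iteratedDeriv_exp_I_mul_ofReal (n : ℕ) :
    iteratedDeriv n (fun t : ℝ => Complex.exp (Complex.I * (t : ℂ))) =
      fun t : ℝ => Complex.I ^ n * Complex.exp (Complex.I * (t : ℂ)) := by
  induction n with
  | zero => simp
  | succ n ih =>
    rw [iteratedDeriv_succ, ih]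
    ext t
    have h : HasDerivAt (fun t : ℝ => Complex.exp (Complex.I * (t : ℂ)))
        (Complex.exp (Complex.I * (t : ℂ)) * (Complex.I * 1)) t :=
      ((Complex.ofRealCLM.hasDerivAt (x := t)).const_mul Complex.I).cexp
    rw [(h.const_mul _).deriv]
    ring

lemma Complex.hasTemperateGrowth_exp_I_mul_ofReal :
    (fun t : ℝ => Complex.exp (Complex.I * (t : ℂ))).HasTemperateGrowth := by
  refine ⟨(contDiff_const.mul Complex.ofRealCLM.contDiff).cexp, fun n => ⟨0, 1, fun t => ?_⟩⟩
  rw [norm_iteratedFDeriv_eq_norm_iteratedDeriv, Complex.iteratedDeriv_exp_I_mul_ofReal]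
  simp [mul_comm Complex.I, Complex.norm_exp_ofReal_mul_I]

lemma Function.HasTemperateGrowth.exp_I_mul {f : E → ℝ} (hf : f.HasTemperateGrowth) :
    (fun x => Complex.exp (Complex.I * (f x : ℂ))).HasTemperateGrowth :=
  Complex.hasTemperateGrowth_exp_I_mul_ofReal.comp hf

lemma Function.HasTemperateGrowth.fderiv {f : E → F} (hf : f.HasTemperateGrowth) :
    (fderiv ℝ f).HasTemperateGrowth := by
  refine ⟨(contDiff_infty_iff_fderiv.1 hf.1).2, fun n => ?_⟩
  obtain ⟨k, C, h⟩ := hf.2 (n + 1)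
  refine ⟨k, C, fun x => ?_⟩
  rw [norm_iteratedFDeriv_fderiv]
  exact h x

lemma Function.HasTemperateGrowth.norm_le {f : E → F} (hf : f.HasTemperateGrowth) :
    ∃ (k : ℕ) (C : ℝ), 0 ≤ C ∧ ∀ x, ‖f x‖ ≤ C * (1 + ‖x‖) ^ k := by
  obtain ⟨k, C, hC, h⟩ := hf.norm_iteratedFDeriv_le_uniform 0
  exact ⟨k, C, hC, fun x => by simpa using h 0 le_rfl x⟩

lemma Function.HasTemperateGrowth.hasFDerivAt_intervalIntegral {f : ℝ × E → F}
    (hf : f.HasTemperateGrowth) (x : E) :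
    HasFDerivAt (fun x => ∫ s in (0 : ℝ)..1, f (s, x))
      (∫ s in (0 : ℝ)..1, (_root_.fderiv ℝ f (s, x)).comp (ContinuousLinearMap.inr ℝ ℝ E)) x := by
  have hcont : ∀ y : E, Continuous fun s : ℝ => f (s, y) := fun y =>
    hf.1.continuous.comp (by fun_prop)
  have hcont' : Continuous fun s : ℝ =>
      (_root_.fderiv ℝ f (s, x)).comp (ContinuousLinearMap.inr ℝ ℝ E) :=
    (hf.fderiv.1.continuous.comp (by fun_prop)).clm_comp continuous_const
  obtain ⟨k, C, hC, hb⟩ := hf.fderiv.norm_le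
  refine intervalIntegral.hasFDerivAt_integral_of_dominated_of_fderiv_le
    (bound := fun _ => C * (2 * (1 + (‖x‖ + 1))) ^ k)
    (F' := fun y s => (_root_.fderiv ℝ f (s, y)).comp (ContinuousLinearMap.inr ℝ ℝ E))
    (Metric.ball_mem_nhds x one_pos) (Eventually.of_forall fun y => (hcont y).aestronglyMeasurable)
    ((hcont x).intervalIntegrable _ _) hcont'.aestronglyMeasurable ?_
    (continuous_const.intervalIntegrable _ _) ?_
  · refine Eventually.of_forall fun s hs y hy => ?_
    have h1 : ‖ContinuousLinearMap.inr ℝ ℝ E‖ ≤ 1 := ContinuousLinearMap.norm_inr_le_one ℝ ℝ E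
    have h2 : ‖y‖ ≤ ‖x‖ + 1 := by
      have := norm_sub_norm_le y x
      rw [mem_ball_iff_norm] at hy
      linarith
    calc _ ≤ ‖_root_.fderiv ℝ f (s, y)‖ * ‖ContinuousLinearMap.inr ℝ ℝ E‖ :=
          ContinuousLinearMap.opNorm_comp_le _ _
      _ ≤ ‖_root_.fderiv ℝ f (s, y)‖ * 1 := by gcongr
      _ ≤ C * (1 + ‖((s, y) : ℝ × E)‖) ^ k := by rw [mul_one]; exact hb _
      _ ≤ C * (2 * (1 + ‖y‖)) ^ k := by
          gcongr
          exact one_add_norm_prodMk_le_of_mem_uIoc hs y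
      _ ≤ _ := by gcongr
  · refine Eventually.of_forall fun s _ y _ => ?_
    have h1 : HasFDerivAt f (_root_.fderiv ℝ f (s, y)) (s, y) :=
      (hf.1.differentiable (by simp)).differentiableAt.hasFDerivAt
    exact h1.comp y (hasFDerivAt_prodMk_right s y)

lemma Function.HasTemperateGrowth.intervalIntegral_aux (n : ℕ) :
    ∀ {F : Type} [NormedAddCommGroup F] [NormedSpace ℝ F] {f : ℝ × E → F},
      f.HasTemperateGrowth → ContDiff ℝ n (fun x => ∫ s in (0 : ℝ)..1, f (s, x)) ∧
        ∃ (k : ℕ) (C : ℝ), ∀ x,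
          ‖iteratedFDeriv ℝ n (fun x => ∫ s in (0 : ℝ)..1, f (s, x)) x‖ ≤ C * (1 + ‖x‖) ^ k := by
  induction n with
  | zero =>
    intro F _ _ f hf
    refine ⟨contDiff_zero.2 (continuous_iff_continuousAt.2 fun x =>
      (hf.hasFDerivAt_intervalIntegral x).continuousAt), ?_⟩
    obtain ⟨k, C, hC, hb⟩ := hf.norm_le
    refine ⟨k, C * 2 ^ k, fun x => ?_⟩
    rw [norm_iteratedFDeriv_zero]
    have := intervalIntegral.norm_integral_le_of_norm_le_const (a := 0) (b := 1)
      (f := fun s => f (s, x)) (C := C * (2 * (1 + ‖x‖)) ^ k) (fun s hs => (hb _).trans (by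
        gcongr
        exact one_add_norm_prodMk_le_of_mem_uIoc hs x))
    simpa [mul_pow, mul_assoc] using this
  | succ n ih =>
    intro F _ _ f hf
    have hd := hf.hasFDerivAt_intervalIntegral
    have hg : (fun p : ℝ × E =>
        (_root_.fderiv ℝ f p).comp (ContinuousLinearMap.inr ℝ ℝ E)).HasTemperateGrowth :=
      hf.fderiv.clm_comp
        ((ContinuousLinearMap.compL ℝ E (ℝ × E) F).flip (ContinuousLinearMap.inr ℝ ℝ E))
    obtain ⟨h1, k, C, h2⟩ := ih hg
    have he : _root_.fderiv ℝ (fun x => ∫ s in (0 : ℝ)..1, f (s, x)) = _ :=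
      funext fun x => (hd x).fderiv
    refine ⟨?_, k, C, fun x => ?_⟩
    · rw [Nat.cast_succ, contDiff_succ_iff_fderiv]
      exact ⟨fun x => (hd x).differentiableAt, by simp, he ▸ h1⟩
    · rw [← norm_iteratedFDeriv_fderiv, he]
      exact h2 x

lemma Function.HasTemperateGrowth.intervalIntegral {f : ℝ × E → F} (hf : f.HasTemperateGrowth) :
    (fun x => ∫ s in (0 : ℝ)..1, f (s, x)).HasTemperateGrowth :=
  ⟨contDiff_infty.2 fun n => (intervalIntegral_aux n hf).1, fun n => (intervalIntegral_aux n hf).2⟩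

lemma Function.HasTemperateGrowth.norm_iteratedFDeriv_slice_le {f : E × F → G}
    (hf : f.HasTemperateGrowth) (n : ℕ) :
    ∃ (k : ℕ) (C : ℝ), 0 ≤ C ∧ ∀ m ≤ n, ∀ x y,
      ‖iteratedFDeriv ℝ m (fun z => f (z, y)) x‖ ≤ C * (1 + ‖x‖) ^ k * (1 + ‖y‖) ^ k := by
  obtain ⟨k, C, hC, h⟩ := hf.norm_iteratedFDeriv_le_uniform n
  refine ⟨k, C, hC, fun m hm x y => ?_⟩
  have he : (fun z => f (z, y)) = (fun p => f (p + (0, y))) ∘ ContinuousLinearMap.inl ℝ E F := by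
    ext z; simp
  have hs : ContDiff ℝ (m : ℕ∞) (fun p => f (p + (0, y))) :=
    (hf.1.of_le (by exact_mod_cast le_top)).comp (contDiff_id.add contDiff_const)
  rw [he, ContinuousLinearMap.iteratedFDeriv_comp_right _ hs x le_rfl]
  refine (ContinuousMultilinearMap.norm_compContinuousLinearMap_le _ _).trans ?_
  rw [iteratedFDeriv_comp_add_right]
  have h1 : ∏ _i : Fin m, ‖ContinuousLinearMap.inl ℝ E F‖ ≤ 1 :=
    Finset.prod_le_one (fun _ _ => norm_nonneg _)
      (fun _ _ => ContinuousLinearMap.norm_inl_le_one ℝ E F)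
  have h2 : 1 + ‖((x, y) : E × F)‖ ≤ (1 + ‖x‖) * (1 + ‖y‖) := by
    have : ‖((x, y) : E × F)‖ ≤ ‖x‖ + ‖y‖ := by
      rw [Prod.norm_mk]
      exact max_le (by linarith [norm_nonneg y]) (by linarith [norm_nonneg x])
    nlinarith [norm_nonneg x, norm_nonneg y]
  calc _ ≤ C * (1 + ‖((x, y) : E × F)‖) ^ k * 1 := by
        gcongr
        simpa using h m hm (x, y)
    _ ≤ C * ((1 + ‖x‖) * (1 + ‖y‖)) ^ k := by rw [mul_one]; gcongr
    _ = _ := by rw [mul_pow]; ring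

end TemperateGrowth

section Gabor

variable {d : ℕ} {B : Fin d → Fin d → (Fin d → ℝ) → ℝ} {g : E1 d → ℝ}

lemma IsRegularMagneticField.hasTemperateGrowth (hB : IsRegularMagneticField d B) (j k : Fin d) :
    (B j k).HasTemperateGrowth := by
  refine ⟨hB.smooth j k, fun n => ?_⟩
  obtain ⟨C, hC⟩ := hB.derivBounded j k n
  exact ⟨0, C, fun x => by simpa using hC x⟩

lemma IsRegularMagneticField.hasTemperateGrowth_magA (hB : IsRegularMagneticField d B)
    (k : Fin d) : (fun x => magA d B 0 x k).HasTemperateGrowth := by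
  refine Function.HasTemperateGrowth.sum fun j _ => ?_
  have hid : (fun p : ℝ × E1 d => p).HasTemperateGrowth := .id'
  exact Function.HasTemperateGrowth.intervalIntegral
    (f := fun p : ℝ × E1 d => p.1 * (p.2 j - 0) * B j k (0 + p.1 • (p.2 - 0)))
    ((hid.fst.mul ((hid.snd.apply j).sub (.const 0))).mul ((hB.hasTemperateGrowth j k).comp
      ((Function.HasTemperateGrowth.const 0).add (hid.fst.smul (hid.snd.sub (.const 0))))))

lemma IsRegularMagneticField.hasTemperateGrowth_magPhi (hB : IsRegularMagneticField d B) :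
    (fun p : E2 d => magPhi d B p.1 p.2).HasTemperateGrowth := by
  refine Function.HasTemperateGrowth.sum fun k _ => ?_
  have hid : (fun p : ℝ × E2 d => p).HasTemperateGrowth := .id'
  exact Function.HasTemperateGrowth.intervalIntegral
    (f := fun p : ℝ × E2 d => magA d B 0 (p.2.2 + p.1 • (p.2.1 - p.2.2)) k * (p.2.1 k - p.2.2 k))
    (((hB.hasTemperateGrowth_magA k).comp
      (hid.snd.snd.add (hid.fst.smul (hid.snd.fst.sub hid.snd.snd)))).mul
      ((hid.snd.fst.apply k).sub (hid.snd.snd.apply k)))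

/-- The magnetic Gabor window `e^{iφ(x,a)}·𝔤(x−a)` as a function of the point `x` and of the
real centre `a`. -/
def gaborWindow (d : ℕ) (B : Fin d → Fin d → E1 d → ℝ) (g : E1 d → ℝ) (p : E2 d) : ℂ :=
  Complex.exp (Complex.I * (magPhi d B p.1 p.2 : ℂ)) * ((g (p.1 - p.2) : ℝ) : ℂ)

/-- The tensor window `w(x,a)·conj(w(y,b))` at the point `(x,y)` with centre `(a,b)`, where `w` is
the magnetic Gabor window. -/
def gaborWindowTensor (d : ℕ) (B : Fin d → Fin d → E1 d → ℝ) (g : E1 d → ℝ) (p : E2 d × E2 d) :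
    ℂ :=
  gaborWindow d B g (p.1.1, p.2.1) * (starRingEnd ℂ) (gaborWindow d B g (p.1.2, p.2.2))

/-- The pairing `(w₁,w₂), (x,y) ↦ w₁·x − w₂·y`. -/
def diffPairing (d : ℕ) (w z : E2 d) : ℝ := ∑ i, w.1 i * z.1 i - ∑ i, w.2 i * z.2 i

/-- Integer points of `ℝ^{2d}` as real points. -/
def intPoint (d : ℕ) (m : Idx d) : E2 d := (fun i => (m.1 i : ℝ), fun i => (m.2 i : ℝ))

/-- The normalizing constant `(2π)^{−d/2}`. -/
def gaborConst (d : ℕ) : ℂ := (((2 * Real.pi) ^ (-(d : ℝ) / 2) : ℝ) : ℂ)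

lemma gaborConst_pow_four (d : ℕ) :
    gaborConst d ^ 4 = (((2 * Real.pi) ^ (2 * d))⁻¹ : ℝ) := by
  have hpi : (0 : ℝ) < 2 * Real.pi := by positivity
  rw [gaborConst, ← Complex.ofReal_pow, ← Real.rpow_natCast, ← Real.rpow_mul hpi.le,
    ← Real.rpow_natCast, ← Real.rpow_neg hpi.le]
  congr 2
  push_cast
  ring

lemma conj_gaborConst (d : ℕ) : (starRingEnd ℂ) (gaborConst d) = gaborConst d :=
  Complex.conj_ofReal _

lemma Complex.conj_exp_I_mul_ofReal (t : ℝ) :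
    (starRingEnd ℂ) (Complex.exp (Complex.I * (t : ℂ))) = Complex.exp (-(Complex.I * (t : ℂ))) := by
  rw [← Complex.exp_conj, map_mul, Complex.conj_I, Complex.conj_ofReal, neg_mul]

lemma gaborTensor_eq (a b : Idx d) (p : E2 d) :
    gaborTensor d B g a b p = gaborConst d ^ 2 *
      gaborWindowTensor d B g (p, intPoint d (a.1, b.1)) *
      Complex.exp (Complex.I *
        (diffPairing d (intPoint d (a.2, b.2)) (p - intPoint d (a.1, b.1)) : ℂ)) := by
  have h : Complex.exp (Complex.I *
        (diffPairing d (intPoint d (a.2, b.2)) (p - intPoint d (a.1, b.1)) : ℂ)) =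
      Complex.exp (Complex.I * ((∑ i, (a.2 i : ℝ) * (p.1 i - (a.1 i : ℝ)) : ℝ) : ℂ)) *
      (starRingEnd ℂ)
        (Complex.exp (Complex.I * ((∑ i, (b.2 i : ℝ) * (p.2 i - (b.1 i : ℝ)) : ℝ) : ℂ))) := by
    rw [Complex.conj_exp_I_mul_ofReal, ← Complex.exp_add, diffPairing, Complex.ofReal_sub, mul_sub,
      sub_eq_add_neg]
    rfl
  rw [h, gaborTensor, gabor, gabor, gaborWindowTensor, gaborWindow, gaborWindow]
  simp only [map_mul, gaborConst, Complex.conj_ofReal, intPoint]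
  ring

lemma frameCoef_eq (a b : Idx d) (F : E2 d → ℂ) :
    frameCoef d B g a b F = gaborConst d ^ 2 * ∫ p : E2 d,
      F p * (starRingEnd ℂ) (gaborWindowTensor d B g (p, intPoint d (a.1, b.1))) *
      Complex.exp (-(Complex.I *
        (diffPairing d (intPoint d (a.2, b.2)) (p - intPoint d (a.1, b.1)) : ℂ))) := by
  rw [frameCoef, ← integral_const_mul]
  congr 1
  ext p
  have h : (starRingEnd ℂ) (gabor d B g a p.1) * gabor d B g b p.2 =
      (starRingEnd ℂ) (gaborTensor d B g a b p) := by
    rw [gaborTensor, map_mul, Complex.conj_conj]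
  rw [mul_assoc, h, gaborTensor_eq, map_mul, map_mul, map_pow, conj_gaborConst,
    Complex.conj_exp_I_mul_ofReal]
  ring

lemma hasTemperateGrowth_gaborWindowTensor (hB : IsRegularMagneticField d B) (hg : IsWindow d g) :
    (gaborWindowTensor d B g).HasTemperateGrowth := by
  have hid : (fun p : E2 d => p).HasTemperateGrowth := .id'
  have hid2 : (fun p : E2 d × E2 d => p).HasTemperateGrowth := .id'
  have hw : (gaborWindow d B g).HasTemperateGrowth :=
    hB.hasTemperateGrowth_magPhi.exp_I_mul.mul
      ((hg.compactSupport.hasTemperateGrowth hg.smooth).comp (hid.fst.sub hid.snd)).ofReal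
  exact (hw.comp (hid2.fst.fst.prodMk hid2.snd.fst)).mul
    (hw.comp (hid2.fst.snd.prodMk hid2.snd.snd)).conj

lemma Function.HasTemperateGrowth.diffPairing {E : Type} [NormedAddCommGroup E] [NormedSpace ℝ E]
    {f h : E → E2 d} (hf : f.HasTemperateGrowth) (hh : h.HasTemperateGrowth) :
    (fun x => _root_.diffPairing d (f x) (h x)).HasTemperateGrowth :=
  (Function.HasTemperateGrowth.sum fun i _ => (hf.fst.apply i).mul (hh.fst.apply i)).sub
    (Function.HasTemperateGrowth.sum fun i _ => (hf.snd.apply i).mul (hh.snd.apply i))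

lemma IsWindow.norm_sub_le_of_gaborWindowTensor_ne_zero (hg : IsWindow d g) {p A : E2 d}
    (h : gaborWindowTensor d B g (p, A) ≠ 0) : ‖p - A‖ ≤ 1 := by
  have key : ∀ x a : E1 d, gaborWindow d B g (x, a) ≠ 0 → ‖x - a‖ ≤ 1 := fun x a hx => by
    have hgx : g (x - a) ≠ 0 := fun h0 => hx (by simp [gaborWindow, h0])
    rw [pi_norm_le_iff_of_nonneg zero_le_one]
    exact fun i => (hg.support_subset _ hgx i).le
  rw [gaborWindowTensor, mul_ne_zero_iff] at h
  rw [Prod.norm_def]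
  exact max_le (key _ _ h.1) (key _ _ fun h0 => h.2 (by simp [h0]))

lemma norm_intPoint (m : Idx d) : ‖intPoint d m‖ = ‖m‖ := by
  have h : ∀ z : ℤ, ‖(z : ℝ)‖₊ = ‖z‖₊ := fun z => NNReal.eq (Int.norm_cast_real z)
  simp only [intPoint, Prod.norm_def, Pi.norm_def, h]

end Gabor

section LocalizedSlices

variable {E : Type} [NormedAddCommGroup E] [NormedSpace ℝ E]

lemma norm_sub_le_of_iteratedFDeriv_slice_ne_zero {f : E × E → ℂ}
    (hs : ∀ x y, f (x, y) ≠ 0 → ‖x - y‖ ≤ 1) {n : ℕ} {x y : E}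
    (h : iteratedFDeriv ℝ n (fun z => f (z, y)) x ≠ 0) : ‖x - y‖ ≤ 1 := by
  have h1 : x ∈ tsupport fun z => f (z, y) := support_iteratedFDeriv_subset n h
  have h2 : IsClosed {z : E | ‖z - y‖ ≤ 1} :=
    isClosed_le (continuous_id.sub continuous_const).norm continuous_const
  exact closure_minimal (fun z hz => hs z y hz) h2 h1

lemma Function.HasTemperateGrowth.pow_norm_mul_norm_iteratedFDeriv_slice_le {F : Type}
    [NormedAddCommGroup F] [NormedSpace ℝ F] {f : E × F → ℂ}
    (hf : f.HasTemperateGrowth) (hs : ∀ x y, f (x, y) ≠ 0 → ‖x‖ ≤ 1 + ‖y‖) (k n : ℕ) :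
    ∃ (M : ℕ) (C : ℝ), 0 ≤ C ∧ ∀ x y,
      ‖x‖ ^ k * ‖iteratedFDeriv ℝ n (fun z => f (z, y)) x‖ ≤ C * (1 + ‖y‖) ^ M := by
  obtain ⟨l, C, hC, h⟩ := hf.norm_iteratedFDeriv_slice_le n
  refine ⟨k + l + l, C * 2 ^ l, by positivity, fun x y => ?_⟩
  by_cases h0 : iteratedFDeriv ℝ n (fun z => f (z, y)) x = 0
  · rw [h0, norm_zero, mul_zero]; positivity
  have h1 : x ∈ tsupport fun z => f (z, y) := support_iteratedFDeriv_subset n h0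
  have h2 : IsClosed {z : E | ‖z‖ ≤ 1 + ‖y‖} := isClosed_le continuous_norm continuous_const
  have h3 : ‖x‖ ≤ 1 + ‖y‖ := closure_minimal (fun z hz => hs z y hz) h2 h1
  calc _ ≤ (1 + ‖y‖) ^ k * (C * (2 * (1 + ‖y‖)) ^ l * (1 + ‖y‖) ^ l) := by
        refine mul_le_mul (by gcongr) ((h n le_rfl x y).trans ?_) (norm_nonneg _) (by positivity)
        gcongr
        linarith [norm_nonneg y]
    _ = _ := by rw [mul_pow]; ring

/-- Multiplying a Schwartz function by windows of temperate growth that are localized near a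
varying centre yields functions whose derivatives decay rapidly, also in the centre. -/
lemma SchwartzMap.pow_mul_norm_iteratedFDeriv_mul_slice_le (F : SchwartzMap E ℂ) {f : E × E → ℂ}
    (hf : f.HasTemperateGrowth) (hs : ∀ x y, f (x, y) ≠ 0 → ‖x - y‖ ≤ 1) (R N n : ℕ) :
    ∃ C : ℝ, 0 ≤ C ∧ ∀ m ≤ n, ∀ x y, (1 + ‖x‖) ^ R * (1 + ‖y‖) ^ N *
      ‖iteratedFDeriv ℝ m (fun z => F z * f (z, y)) x‖ ≤ C := by
  obtain ⟨l, C, hC, h⟩ := hf.norm_iteratedFDeriv_slice_le n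
  set D := 2 ^ (R + (l + (N + l))) * (Finset.Iic (R + (l + (N + l)), n)).sup
    (fun m => SchwartzMap.seminorm ℝ m.1 m.2) F with hD
  have hFD : ∀ i ≤ n, ∀ x, (1 + ‖x‖) ^ (R + (l + (N + l))) * ‖iteratedFDeriv ℝ i F x‖ ≤ D :=
    fun i hi x => SchwartzMap.one_add_le_sup_seminorm_apply (𝕜 := ℝ)
      (m := (R + (l + (N + l)), n)) le_rfl hi F x
  have hD0 : 0 ≤ D := le_trans (by positivity) (hFD 0 (Nat.zero_le n) 0)
  have hfy : ∀ y, ContDiff ℝ (⊤ : ℕ∞) fun z => f (z, y) := fun y =>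
    hf.1.comp (contDiff_id.prodMk contDiff_const)
  refine ⟨2 ^ n * (2 ^ (N + l) * C * D), by positivity, fun m hm x y => ?_⟩
  have hterm : ∀ i ∈ Finset.range (m + 1), (1 + ‖x‖) ^ R * (1 + ‖y‖) ^ N *
      (‖iteratedFDeriv ℝ i F x‖ * ‖iteratedFDeriv ℝ (m - i) (fun z => f (z, y)) x‖) ≤
      2 ^ (N + l) * C * D := by
    intro i hi
    rw [Finset.mem_range] at hi
    by_cases h0 : iteratedFDeriv ℝ (m - i) (fun z => f (z, y)) x = 0
    · rw [h0, norm_zero, mul_zero, mul_zero]; positivity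
    have h1 := norm_sub_le_of_iteratedFDeriv_slice_ne_zero hs h0
    have h2 : 1 + ‖y‖ ≤ 2 * (1 + ‖x‖) := by
      have := norm_sub_norm_le y x
      rw [norm_sub_rev] at this
      linarith [norm_nonneg x]
    calc _ ≤ (1 + ‖x‖) ^ R * (1 + ‖y‖) ^ N *
          (‖iteratedFDeriv ℝ i F x‖ * (C * (1 + ‖x‖) ^ l * (1 + ‖y‖) ^ l)) := by
          gcongr
          exact h (m - i) (by omega) x y
      _ = (1 + ‖x‖) ^ R * (1 + ‖x‖) ^ l * (1 + ‖y‖) ^ (N + l) * C * ‖iteratedFDeriv ℝ i F x‖ := by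
          ring
      _ ≤ (1 + ‖x‖) ^ R * (1 + ‖x‖) ^ l * (2 * (1 + ‖x‖)) ^ (N + l) * C *
          ‖iteratedFDeriv ℝ i F x‖ := by gcongr
      _ = 2 ^ (N + l) * C *
          ((1 + ‖x‖) ^ (R + (l + (N + l))) * ‖iteratedFDeriv ℝ i F x‖) := by
          rw [mul_pow]; ring
      _ ≤ _ := by gcongr; exact hFD i (by omega) x
  calc _ ≤ (1 + ‖x‖) ^ R * (1 + ‖y‖) ^ N * ∑ i ∈ Finset.range (m + 1), (m.choose i : ℝ) *
        ‖iteratedFDeriv ℝ i F x‖ * ‖iteratedFDeriv ℝ (m - i) (fun z => f (z, y)) x‖ := by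
        gcongr
        exact norm_iteratedFDeriv_mul_le (N := ((⊤ : ℕ∞) : WithTop ℕ∞)) (F.smooth _) (hfy y) x
          (by exact_mod_cast le_top)
    _ = ∑ i ∈ Finset.range (m + 1), (m.choose i : ℝ) * ((1 + ‖x‖) ^ R * (1 + ‖y‖) ^ N *
        (‖iteratedFDeriv ℝ i F x‖ * ‖iteratedFDeriv ℝ (m - i) (fun z => f (z, y)) x‖)) := by
        rw [Finset.mul_sum]
        exact Finset.sum_congr rfl fun i _ => by ring
    _ ≤ ∑ i ∈ Finset.range (m + 1), (m.choose i : ℝ) * (2 ^ (N + l) * C * D) := by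
        exact Finset.sum_le_sum fun i hi =>
          mul_le_mul_of_nonneg_left (hterm i hi) (Nat.cast_nonneg _)
    _ = 2 ^ m * (2 ^ (N + l) * C * D) := by
        rw [← Finset.sum_mul]
        congr 1
        exact_mod_cast Nat.sum_range_choose m
    _ ≤ _ := by
        gcongr
        exact one_le_two

lemma integrable_and_integral_norm_iteratedFDeriv_le [FiniteDimensional ℝ E] [MeasurableSpace E]
    [BorelSpace E] (μ : Measure E) [μ.IsAddHaarMeasure] :
    ∃ (R : ℕ) (C₀ : ℝ), 0 ≤ C₀ ∧ ∀ (K : E → ℂ) (C : ℝ) (m : ℕ), ContDiff ℝ (⊤ : ℕ∞) K →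
      (∀ x, (1 + ‖x‖) ^ R * ‖iteratedFDeriv ℝ m K x‖ ≤ C) →
      Integrable (fun x => ‖iteratedFDeriv ℝ m K x‖) μ ∧
        ∫ x, ‖iteratedFDeriv ℝ m K x‖ ∂μ ≤ C * C₀ := by
  have hR : (Module.finrank ℝ E : ℝ) < ((Module.finrank ℝ E + 1 : ℕ) : ℝ) := by
    push_cast; linarith
  have hi := integrable_one_add_norm (μ := μ) hR
  refine ⟨Module.finrank ℝ E + 1, ∫ x, (1 + ‖x‖) ^ (-((Module.finrank ℝ E + 1 : ℕ) : ℝ)) ∂μ,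
    integral_nonneg fun x => by positivity, fun K C m hK hb => ?_⟩
  have hle : ∀ x, ‖iteratedFDeriv ℝ m K x‖ ≤
      C * (1 + ‖x‖) ^ (-((Module.finrank ℝ E + 1 : ℕ) : ℝ)) := fun x => by
    rw [Real.rpow_neg (by positivity), Real.rpow_natCast, ← div_eq_mul_inv,
      le_div_iff₀ (by positivity), mul_comm]
    exact hb x
  have hint : Integrable (fun x => ‖iteratedFDeriv ℝ m K x‖) μ :=
    (hi.const_mul C).mono'
      (hK.continuous_iteratedFDeriv (by exact_mod_cast le_top)).norm.aestronglyMeasurable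
      (Eventually.of_forall fun x => by rw [norm_norm]; exact hle x)
  refine ⟨hint, ?_⟩
  rw [← integral_const_mul]
  exact integral_mono hint (hi.const_mul C) hle

end LocalizedSlices

section FourierDecay

variable {d : ℕ}

/-- The bilinear form `(z,w) ↦ (2π)⁻¹ (w₁·z₁ − w₂·z₂)`. -/
def diffPairingCLM (d : ℕ) : E2 d →L[ℝ] E2 d →L[ℝ] ℝ :=
  (2 * Real.pi)⁻¹ •
    (∑ i, (((ContinuousLinearMap.proj (R := ℝ) (φ := fun _ : Fin d => ℝ) i).comp
        (ContinuousLinearMap.fst ℝ (E1 d) (E1 d))).smulRight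
      ((ContinuousLinearMap.proj (R := ℝ) (φ := fun _ : Fin d => ℝ) i).comp
        (ContinuousLinearMap.fst ℝ (E1 d) (E1 d)))) -
    ∑ i, (((ContinuousLinearMap.proj (R := ℝ) (φ := fun _ : Fin d => ℝ) i).comp
        (ContinuousLinearMap.snd ℝ (E1 d) (E1 d))).smulRight
      ((ContinuousLinearMap.proj (R := ℝ) (φ := fun _ : Fin d => ℝ) i).comp
        (ContinuousLinearMap.snd ℝ (E1 d) (E1 d)))))

lemma diffPairingCLM_apply (z w : E2 d) :
    diffPairingCLM d z w = (2 * Real.pi)⁻¹ * diffPairing d w z := by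
  simp [diffPairingCLM, diffPairing, mul_comm]

instance : (volume : Measure (E2 d)).IsAddHaarMeasure :=
  Measure.prod.instIsAddHaarMeasure volume volume

lemma integral_mul_exp_eq_fourierIntegral (K : E2 d → ℂ) (w : E2 d) :
    ∫ p : E2 d, K p * Complex.exp (-(Complex.I * (diffPairing d w p : ℂ))) =
      VectorFourier.fourierIntegral Real.fourierChar volume (diffPairingCLM d).toLinearMap₁₂
        K w := by
  rw [VectorFourier.fourierIntegral]
  congr 1
  ext p
  change _ = Real.fourierChar (-(diffPairingCLM d p w)) • K p
  rw [diffPairingCLM_apply, Circle.smul_def,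
    Real.fourierChar_apply, smul_eq_mul, mul_comm]
  congr 2
  push_cast
  field_simp

lemma exists_norm_apply_eq_norm {ι : Type} [Fintype ι] [Nonempty ι] (x : ι → ℝ) :
    ∃ i, |x i| = ‖x‖ := by
  obtain ⟨i, -, hi⟩ := Finset.exists_mem_eq_sup Finset.univ Finset.univ_nonempty fun i => ‖x i‖₊
  exact ⟨i, by rw [Pi.norm_def, hi, coe_nnnorm, Real.norm_eq_abs]⟩

lemma exists_norm_le_one_abs_diffPairing_eq_norm (hd : 0 < d) (w : E2 d) :
    ∃ v : E2 d, ‖v‖ ≤ 1 ∧ |diffPairing d w v| = ‖w‖ := by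
  have : Nonempty (Fin d) := ⟨⟨0, hd⟩⟩
  rcases le_total ‖w.2‖ ‖w.1‖ with h | h
  · obtain ⟨i, hi⟩ := exists_norm_apply_eq_norm w.1
    refine ⟨(Pi.single i 1, 0), by simp [Prod.norm_def, Pi.norm_single], ?_⟩
    rw [Prod.norm_def, max_eq_left h, ← hi]
    simp [diffPairing, Pi.single_apply]
  · obtain ⟨i, hi⟩ := exists_norm_apply_eq_norm w.2
    refine ⟨(0, Pi.single i 1), by simp [Prod.norm_def, Pi.norm_single], ?_⟩
    rw [Prod.norm_def, max_eq_right h, ← hi]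
    simp [diffPairing, Pi.single_apply]

lemma one_add_pow_mul_norm_integral_mul_exp_le (hd : 0 < d) (n : ℕ) {K : E2 d → ℂ} {S : ℝ}
    (hK : ContDiff ℝ (⊤ : ℕ∞) K)
    (hint : ∀ m, Integrable fun x => ‖iteratedFDeriv ℝ m K x‖)
    (hS : ∀ m ≤ n, ∫ x, ‖iteratedFDeriv ℝ m K x‖ ≤ S) (w : E2 d) :
    (1 + ‖w‖) ^ n * ‖∫ p : E2 d, K p * Complex.exp (-(Complex.I * (diffPairing d w p : ℂ)))‖ ≤
      2 ^ n * (1 + (2 * Real.pi) ^ n * (2 ^ n * (n + 1))) * S := by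
  set J := ‖∫ p : E2 d, K p * Complex.exp (-(Complex.I * (diffPairing d w p : ℂ)))‖ with hJ
  have key : ∀ m ≤ n, ‖w‖ ^ m * J ≤ (2 * Real.pi) ^ m * (2 ^ m * ((m + 1) * S)) := by
    intro m hm
    obtain ⟨v, hv, hvw⟩ := exists_norm_le_one_abs_diffPairing_eq_norm hd w
    have h := VectorFourier.pow_mul_norm_iteratedFDeriv_fourierIntegral_le (diffPairingCLM d)
      (μ := (volume : Measure (E2 d))) (K := 0) (N := ⊤) (f := K) (k := 0) (n := m) hK
      (fun k i hk _ => by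
        obtain rfl : k = 0 := by simpa using hk
        simpa using hint i) le_rfl le_top v w
    rw [norm_iteratedFDeriv_zero, ← integral_mul_exp_eq_fourierIntegral, ← hJ,
      diffPairingCLM_apply, abs_mul, hvw, abs_of_nonneg (by positivity), mul_pow, inv_pow,
      mul_assoc, inv_mul_le_iff₀ (by positivity)] at h
    have hsum : ∑ p ∈ Finset.range (0 + 1) ×ˢ Finset.range (m + 1),
        ∫ v : E2 d, ‖v‖ ^ p.1 * ‖iteratedFDeriv ℝ p.2 K v‖ ≤ (m + 1) * S := by
      rw [Finset.sum_product]
      simp only [zero_add, Finset.range_one, Finset.sum_singleton, pow_zero, one_mul]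
      refine (Finset.sum_le_sum fun i hi => hS i ?_).trans_eq ?_
      · rw [Finset.mem_range] at hi; omega
      · simp
    have hsum0 : 0 ≤ ∑ p ∈ Finset.range (0 + 1) ×ˢ Finset.range (m + 1),
        ∫ v : E2 d, ‖v‖ ^ p.1 * ‖iteratedFDeriv ℝ p.2 K v‖ :=
      Finset.sum_nonneg fun p _ => integral_nonneg fun x => by positivity
    have hv1 : ‖v‖ ^ m ≤ 1 := pow_le_one₀ (norm_nonneg _) hv
    have hS0 := hsum0.trans hsum
    refine h.trans (mul_le_mul_of_nonneg_left ?_ (by positivity))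
    rw [pow_zero, mul_one, Nat.cast_zero, mul_zero, zero_add]
    calc _ ≤ 1 * 2 ^ m * ((m + 1) * S) := by gcongr
      _ = _ := by ring
  have h0 := key 0 (Nat.zero_le n)
  have hn := key n le_rfl
  simp only [pow_zero, one_mul, Nat.cast_zero, zero_add] at h0
  have hadd : (1 + ‖w‖) ^ n ≤ 2 ^ n * (1 + ‖w‖ ^ n) := by
    have := add_pow_le zero_le_one (norm_nonneg w) n
    rw [one_pow] at this
    refine this.trans ?_
    gcongr
    · exact one_le_two
    · omega
  calc _ ≤ 2 ^ n * (1 + ‖w‖ ^ n) * J := by gcongr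
    _ = 2 ^ n * (J + ‖w‖ ^ n * J) := by ring
    _ ≤ 2 ^ n * (S + (2 * Real.pi) ^ n * (2 ^ n * ((n + 1) * S))) := by gcongr
    _ = _ := by ring

end FourierDecay

section IntegerSums

lemma summable_one_add_norm_int_sq_inv : Summable fun a : ℤ => ((1 + ‖a‖) ^ 2)⁻¹ := by
  have h : Summable fun n : ℕ => ((1 + (n : ℝ)) ^ 2)⁻¹ := by
    have := (summable_nat_add_iff 1).2 (Real.summable_nat_pow_inv.2 one_lt_two)
    simpa [add_comm] using this
  refine Summable.of_nat_of_neg ?_ ?_ <;> simpa [Int.norm_eq_abs] using h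

lemma exists_summable_one_add_norm_pow_inv_pi (d : ℕ) :
    ∃ R : ℕ, Summable fun m : Fin d → ℤ => ((1 + ‖m‖) ^ R)⁻¹ := by
  induction d with
  | zero => exact ⟨0, Summable.of_finite⟩
  | succ n ih =>
    obtain ⟨R, hR⟩ := ih
    refine ⟨2 + R, ?_⟩
    rw [← (Fin.consEquiv fun _ : Fin (n + 1) => ℤ).summable_iff]
    refine Summable.of_nonneg_of_le (fun _ => inv_nonneg.2 (by positivity)) (fun p => ?_)
      (summable_one_add_norm_int_sq_inv.mul_of_nonneg hR (fun _ => by positivity)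
        (fun _ => by positivity))
    have h1 : ‖p.1‖ ≤ ‖Fin.consEquiv (fun _ : Fin (n + 1) => ℤ) p‖ :=
      norm_le_pi_norm (Fin.consEquiv (fun _ : Fin (n + 1) => ℤ) p) 0
    have h2 : ‖p.2‖ ≤ ‖Fin.consEquiv (fun _ : Fin (n + 1) => ℤ) p‖ :=
      (pi_norm_le_iff_of_nonneg (norm_nonneg _)).2 fun i => by
        simpa using norm_le_pi_norm (Fin.consEquiv (fun _ : Fin (n + 1) => ℤ) p) i.succ
    rw [← mul_inv, Function.comp_apply, pow_add]
    gcongr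

lemma exists_summable_one_add_norm_pow_inv_prod {α β : Type} [NormedAddCommGroup α]
    [NormedAddCommGroup β] (hα : ∃ R : ℕ, Summable fun m : α => ((1 + ‖m‖) ^ R)⁻¹)
    (hβ : ∃ R : ℕ, Summable fun m : β => ((1 + ‖m‖) ^ R)⁻¹) :
    ∃ R : ℕ, Summable fun m : α × β => ((1 + ‖m‖) ^ R)⁻¹ := by
  obtain ⟨R, hR⟩ := hα
  obtain ⟨S, hS⟩ := hβ
  refine ⟨R + S, Summable.of_nonneg_of_le (fun _ => by positivity) (fun p => ?_)
    (hR.mul_of_nonneg hS (fun _ => by positivity) (fun _ => by positivity))⟩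
  rw [← mul_inv, pow_add]
  have h1 := norm_fst_le p
  have h2 := norm_snd_le p
  gcongr

end IntegerSums

section GaborDecay

variable {d : ℕ} {B : Fin d → Fin d → E1 d → ℝ} {g : E1 d → ℝ}

lemma exists_seminorm_gaborTensor_le (hB : IsRegularMagneticField d B) (hg : IsWindow d g)
    (k n : ℕ) : ∃ (M : ℕ) (C : ℝ), 0 ≤ C ∧ ∀ (a b : Idx d) (f : SchwartzMap (E2 d) ℂ),
      ⇑f = gaborTensor d B g a b → SchwartzMap.seminorm ℝ k n f ≤
        C * ((1 + ‖(a.1, b.1)‖) * (1 + ‖(a.2, b.2)‖)) ^ M := by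
  have hid : (fun p : E2 d × (E2 d × E2 d) => p).HasTemperateGrowth := .id'
  have ht : (fun p : E2 d × (E2 d × E2 d) => gaborConst d ^ 2 *
      gaborWindowTensor d B g (p.1, p.2.1) *
      Complex.exp (Complex.I * (diffPairing d p.2.2 (p.1 - p.2.1) : ℂ))).HasTemperateGrowth :=
    ((Function.HasTemperateGrowth.const _).mul
      ((hasTemperateGrowth_gaborWindowTensor hB hg).comp (hid.fst.prodMk hid.snd.fst))).mul
      (Function.HasTemperateGrowth.diffPairing hid.snd.snd (hid.fst.sub hid.snd.fst)).exp_I_mul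
  obtain ⟨M, C, hC, h⟩ := ht.pow_norm_mul_norm_iteratedFDeriv_slice_le (fun x y hxy => by
    have h1 := hg.norm_sub_le_of_gaborWindowTensor_ne_zero
      (right_ne_zero_of_mul (left_ne_zero_of_mul hxy))
    have h2 := norm_sub_norm_le x y.1
    have h3 := norm_fst_le y
    linarith) k n
  refine ⟨M, C, hC, fun a b f hf => SchwartzMap.seminorm_le_bound _ _ _ _ (by positivity)
    fun x => ?_⟩
  have hf' : ⇑f = fun z => gaborConst d ^ 2 *
      gaborWindowTensor d B g (z, intPoint d (a.1, b.1)) *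
      Complex.exp (Complex.I *
        (diffPairing d (intPoint d (a.2, b.2)) (z - intPoint d (a.1, b.1)) : ℂ)) :=
    hf.trans (funext fun z => gaborTensor_eq a b z)
  rw [hf']
  refine (h x (intPoint d (a.1, b.1), intPoint d (a.2, b.2))).trans ?_
  gcongr
  have : ‖(intPoint d (a.1, b.1), intPoint d (a.2, b.2))‖ ≤ ‖(a.1, b.1)‖ + ‖(a.2, b.2)‖ := by
    rw [Prod.norm_mk, norm_intPoint, norm_intPoint]
    exact max_le_add_of_nonneg (norm_nonneg _) (norm_nonneg _)
  nlinarith [norm_nonneg (a.1, b.1), norm_nonneg (a.2, b.2)]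

lemma hasTemperateGrowth_conj_gaborWindowTensor (hB : IsRegularMagneticField d B)
    (hg : IsWindow d g) :
    (fun p => (starRingEnd ℂ) (gaborWindowTensor d B g p)).HasTemperateGrowth :=
  (hasTemperateGrowth_gaborWindowTensor hB hg).conj

lemma exists_norm_frameCoef_le (hd : 0 < d) (hB : IsRegularMagneticField d B) (hg : IsWindow d g)
    (F : SchwartzMap (E2 d) ℂ) (N : ℕ) : ∃ C : ℝ, 0 ≤ C ∧ ∀ a b : Idx d,
      ((1 + ‖(a.1, b.1)‖) * (1 + ‖(a.2, b.2)‖)) ^ N * ‖frameCoef d B g a b F‖ ≤ C := by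
  obtain ⟨R, C₀, hC₀, hint⟩ :=
    integrable_and_integral_norm_iteratedFDeriv_le (volume : Measure (E2 d))
  have hf := hasTemperateGrowth_conj_gaborWindowTensor hB hg
  have hs : ∀ x y : E2 d, (starRingEnd ℂ) (gaborWindowTensor d B g (x, y)) ≠ 0 → ‖x - y‖ ≤ 1 :=
    fun x y h => hg.norm_sub_le_of_gaborWindowTensor_ne_zero fun h0 => h (by rw [h0, map_zero])
  obtain ⟨C, hC, hN⟩ := F.pow_mul_norm_iteratedFDeriv_mul_slice_le hf hs R N N
  refine ⟨‖gaborConst d ^ 2‖ * (2 ^ N * (1 + (2 * Real.pi) ^ N * (2 ^ N * (N + 1))) * (C * C₀)),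
    by positivity, fun a b => ?_⟩
  set A := intPoint d (a.1, b.1) with hA
  set A' := intPoint d (a.2, b.2) with hA'
  set K : E2 d → ℂ := fun z => F z * (starRingEnd ℂ) (gaborWindowTensor d B g (z, A)) with hKdef
  have hK : ContDiff ℝ (⊤ : ℕ∞) K :=
    (F.smooth _).mul (hf.1.comp (contDiff_id.prodMk contDiff_const))
  have hKint : ∀ m, Integrable fun x => ‖iteratedFDeriv ℝ m K x‖ := fun m => by
    obtain ⟨C', -, h'⟩ := F.pow_mul_norm_iteratedFDeriv_mul_slice_le hf hs R 0 m
    exact (hint K C' m hK fun x => by simpa using h' m le_rfl x A).1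
  have hKS : ∀ m ≤ N, ∫ x, ‖iteratedFDeriv ℝ m K x‖ ≤ ((1 + ‖A‖) ^ N)⁻¹ * C * C₀ := fun m hm =>
    (hint K _ m hK fun x => by
      rw [inv_mul_eq_div, le_div_iff₀ (by positivity), mul_right_comm]
      exact hN m hm x A).2
  have hmain := one_add_pow_mul_norm_integral_mul_exp_le hd N hK hKint hKS A'
  have hcoef : ‖frameCoef d B g a b F‖ = ‖gaborConst d ^ 2‖ *
      ‖∫ p : E2 d, K p * Complex.exp (-(Complex.I * (diffPairing d A' p : ℂ)))‖ := by
    have he : ∀ p : E2 d, F p * (starRingEnd ℂ) (gaborWindowTensor d B g (p, A)) *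
        Complex.exp (-(Complex.I * (diffPairing d A' (p - A) : ℂ))) =
        Complex.exp ((diffPairing d A' A : ℂ) * Complex.I) *
          (K p * Complex.exp (-(Complex.I * (diffPairing d A' p : ℂ)))) := fun p => by
      have hsub : diffPairing d A' (p - A) = diffPairing d A' p - diffPairing d A' A := by
        simp only [diffPairing, Prod.fst_sub, Prod.snd_sub, Pi.sub_apply, mul_sub,
          Finset.sum_sub_distrib]
        ring
      rw [hsub, mul_left_comm, ← Complex.exp_add]
      congr 2
      push_cast
      ring
    rw [frameCoef_eq, ← hA, ← hA']
    simp_rw [he]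
    rw [integral_const_mul, norm_mul, norm_mul, Complex.norm_exp_ofReal_mul_I, one_mul]
  rw [hcoef, ← norm_intPoint, ← norm_intPoint, ← hA, ← hA', mul_pow]
  calc _ = ‖gaborConst d ^ 2‖ * ((1 + ‖A‖) ^ N * ((1 + ‖A'‖) ^ N *
        ‖∫ p : E2 d, K p * Complex.exp (-(Complex.I * (diffPairing d A' p : ℂ)))‖)) := by ring
    _ ≤ ‖gaborConst d ^ 2‖ * ((1 + ‖A‖) ^ N *
        (2 ^ N * (1 + (2 * Real.pi) ^ N * (2 ^ N * (N + 1))) *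
          (((1 + ‖A‖) ^ N)⁻¹ * C * C₀))) := by gcongr
    _ = _ := by
      have : (1 + ‖A‖) ^ N ≠ 0 := by positivity
      field_simp

lemma summable_norm_frameCoef_mul_seminorm (hd : 0 < d) (hB : IsRegularMagneticField d B)
    (hg : IsWindow d g) (F : SchwartzMap (E2 d) ℂ) (GT : Idx2 d → SchwartzMap (E2 d) ℂ)
    (hGT : ∀ q : Idx2 d, ⇑(GT q) = gaborTensor d B g q.1 q.2) (k n : ℕ) :
    Summable fun q : Idx2 d =>
      SchwartzMap.seminorm ℝ k n (frameCoef d B g q.1 q.2 F • GT q) := by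
  obtain ⟨R, hR⟩ := exists_summable_one_add_norm_pow_inv_prod
    (exists_summable_one_add_norm_pow_inv_pi d) (exists_summable_one_add_norm_pow_inv_pi d)
  obtain ⟨M, C, hC, hM⟩ := exists_seminorm_gaborTensor_le hB hg k n
  obtain ⟨D, hD, hN⟩ := exists_norm_frameCoef_le hd hB hg F (M + R)
  have hsum := hR.mul_of_nonneg hR (fun _ => by positivity) (fun _ => by positivity)
  rw [← (Equiv.prodProdProdComm (Fin d → ℤ) (Fin d → ℤ) (Fin d → ℤ)
    (Fin d → ℤ)).summable_iff] at hsum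
  refine Summable.of_nonneg_of_le (fun _ => apply_nonneg _ _) (fun q => ?_) (hsum.mul_left (D * C))
  set W := (1 + ‖(q.1.1, q.2.1)‖) * (1 + ‖(q.1.2, q.2.2)‖) with hW
  have hW0 : 0 < W := by positivity
  have hsm : SchwartzMap.seminorm ℝ k n (frameCoef d B g q.1 q.2 F • GT q) =
      ‖frameCoef d B g q.1 q.2 F‖ * SchwartzMap.seminorm ℝ k n (GT q) :=
    map_smul_eq_mul (SchwartzMap.seminorm ℂ k n) _ _
  have h1 := hN q.1 q.2
  have h2 := hM q.1 q.2 (GT q) (hGT q)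
  rw [← hW] at h1 h2
  have h3 : ‖frameCoef d B g q.1 q.2 F‖ ≤ D * (W ^ (M + R))⁻¹ := by
    rw [← div_eq_mul_inv, le_div_iff₀ (by positivity), mul_comm]
    exact h1
  rw [hsm]
  calc _ ≤ (D * (W ^ (M + R))⁻¹) * (C * W ^ M) := by gcongr
    _ = D * C * (W ^ R)⁻¹ := by
      rw [pow_add]
      field_simp
    _ = _ := by
      rw [hW, mul_pow, mul_inv]
      rfl

end GaborDecay

section SchwartzSeries

lemma HasSum.norm_sum_sub_le {ι G : Type} [NormedAddCommGroup G] {u : ι → G} {v : ι → ℝ} {U : G}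
    {V : ℝ} (hu : HasSum u U) (hv : HasSum v V) (h : ∀ i, ‖u i‖ ≤ v i) (s : Finset ι) :
    ‖∑ i ∈ s, u i - U‖ ≤ V - ∑ i ∈ s, v i := by
  classical
  refine le_of_tendsto_of_tendsto (tendsto_const_nhds.sub hu).norm (hv.sub_const _)
    ((eventually_ge_atTop s).mono fun t ht => ?_)
  change ‖∑ i ∈ s, u i - ∑ i ∈ t, u i‖ ≤ ∑ i ∈ t, v i - ∑ i ∈ s, v i
  rw [norm_sub_rev, ← Finset.sum_sdiff ht, ← Finset.sum_sdiff ht, add_sub_cancel_right,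
    add_sub_cancel_right]
  exact norm_sum_le_of_le _ fun i _ => h i

variable {E : Type} [NormedAddCommGroup E] [NormedSpace ℝ E]

lemma SchwartzMap.iteratedFDeriv_sum_sub {ι : Type} (f : ι → SchwartzMap E ℂ)
    (F : SchwartzMap E ℂ) (s : Finset ι) (n : ℕ) (x : E) :
    iteratedFDeriv ℝ n ⇑(∑ i ∈ s, f i - F) x =
      ∑ i ∈ s, iteratedFDeriv ℝ n (f i) x - iteratedFDeriv ℝ n F x := by
  have h : ⇑(∑ i ∈ s, f i - F) = (fun x => ∑ i ∈ s, f i x) - ⇑F := by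
    ext x
    simp
  rw [h, iteratedFDeriv_sub_apply (ContDiff.contDiffAt
    (ContDiff.sum fun i _ => (f i).smooth n)) (F.smooth n).contDiffAt,
    iteratedFDeriv_fun_sum_apply fun i _ => ((f i).smooth n).contDiffAt]

lemma SchwartzMap.hasSum_of_summable_seminorm {ι : Type} {f : ι → SchwartzMap E ℂ}
    {F : SchwartzMap E ℂ} (hs : ∀ k n, Summable fun i => SchwartzMap.seminorm ℝ k n (f i))
    (hp : ∀ x, HasSum (fun i => f i x) (F x)) : HasSum f F := by
  have hF : ⇑F = fun x => ∑' i, f i x := funext fun x => (hp x).tsum_eq.symm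
  have hle : ∀ (n : ℕ) (i : ι) (x : E),
      ‖iteratedFDeriv ℝ n (f i) x‖ ≤ SchwartzMap.seminorm ℝ 0 n (f i) := fun n i x => by
    simpa using SchwartzMap.le_seminorm ℝ 0 n (f i) x
  have hder : ∀ (n : ℕ) (x : E),
      HasSum (fun i => iteratedFDeriv ℝ n (f i) x) (iteratedFDeriv ℝ n F x) := fun n x => by
    have h1 : Summable fun i => iteratedFDeriv ℝ n (f i) x :=
      Summable.of_norm_bounded (hs 0 n) fun i => hle n i x
    have h2 := iteratedFDeriv_tsum_apply (𝕜 := ℝ) (N := ⊤) (f := fun i => ⇑(f i))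
      (fun i => (f i).smooth _) (fun n _ => hs 0 n) (fun n i x _ => hle n i x) (k := n) le_top x
    rw [hF, h2]
    exact h1.hasSum
  have hsemi : ∀ k n (s : Finset ι), SchwartzMap.seminorm ℝ k n (∑ i ∈ s, f i - F) ≤
      ∑' i, SchwartzMap.seminorm ℝ k n (f i) - ∑ i ∈ s, SchwartzMap.seminorm ℝ k n (f i) := by
    intro k n s
    refine SchwartzMap.seminorm_le_bound _ _ _ _
      (sub_nonneg.2 ((hs k n).sum_le_tsum s fun i _ => apply_nonneg _ _)) fun x => ?_
    have h := HasSum.norm_sum_sub_le ((hder n x).const_smul (‖x‖ ^ k)) (hs k n).hasSum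
      (fun i => by
        rw [norm_smul, norm_pow, norm_norm]
        exact SchwartzMap.le_seminorm ℝ k n (f i) x) s
    rwa [← Finset.smul_sum, ← smul_sub, norm_smul, norm_pow, norm_norm,
      ← SchwartzMap.iteratedFDeriv_sum_sub] at h
  rw [HasSum, (schwartz_withSeminorms ℝ E ℂ).tendsto_nhds]
  rintro ⟨k, n⟩ ε hε
  have hlim : Tendsto (fun s : Finset ι => ∑' i, SchwartzMap.seminorm ℝ k n (f i) -
      ∑ i ∈ s, SchwartzMap.seminorm ℝ k n (f i)) atTop (nhds 0) := by
    rw [← sub_self (∑' i, SchwartzMap.seminorm ℝ k n (f i))]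
    exact tendsto_const_nhds.sub (hs k n).hasSum
  exact (hlim.eventually_lt_const hε).mono fun s h => (hsemi k n s).trans_lt h

end SchwartzSeries

section FourierBox

variable {ι : Type}

/-- The periodization of a function supported in `(−1/2,1/2]^ι`, as a function on the torus. -/
def UnitAddTorus.periodize (k : (ι → ℝ) → ℂ) (t : UnitAddTorus ι) : ℂ :=
  k fun i => (AddCircle.equivIoc 1 (-(1 / 2)) (t i) : ℝ)

lemma UnitAddTorus.periodize_coe {k : (ι → ℝ) → ℂ} (x : ι → ℝ)
    (hx : ∀ i, x i ∈ Set.Ioc (-(1 / 2) : ℝ) (-(1 / 2) + 1)) :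
    UnitAddTorus.periodize k (fun i => (x i : UnitAddCircle)) = k x := by
  rw [UnitAddTorus.periodize]
  congr 1
  ext i
  exact AddCircle.equivIoc_coe_of_mem (hx i)

variable [Fintype ι]

lemma UnitAddTorus.mFourier_coe_apply (n : ι → ℤ) (x : ι → ℝ) :
    UnitAddTorus.mFourier n (fun i => (x i : UnitAddCircle)) =
      Complex.exp (Complex.I * ((∑ i, (n i : ℝ) * (2 * Real.pi * x i) : ℝ) : ℂ)) := by
  change ∏ i, fourier (n i) (x i : UnitAddCircle) = _
  simp_rw [fourier_coe_apply]
  rw [← Complex.exp_sum, Complex.ofReal_sum, Finset.mul_sum]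
  congr 1
  refine Finset.sum_congr rfl fun i _ => ?_
  push_cast
  ring

lemma UnitAddTorus.periodize_coe_sub {k : (ι → ℝ) → ℂ} (hk : ∀ x, k x ≠ 0 → ∀ i, |x i| < 1 / 4)
    (x : ι → ℝ) (m : ι → ℤ) (hx : ∀ i, |x i - m i| < 3 / 4) :
    UnitAddTorus.periodize k (fun i => (x i : UnitAddCircle)) = k fun i => x i - m i := by
  have h1 : ∀ i, ∃ n : ℤ, (AddCircle.equivIoc 1 (-(1 / 2)) (x i : UnitAddCircle) : ℝ) = x i - n :=
    fun i => ⟨toIocDiv one_pos (-(1 / 2)) (x i), by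
      rw [AddCircle.equivIoc, QuotientAddGroup.equivIocMod_coe]
      simp [toIocMod]⟩
  choose n hn using h1
  have h2 : ∀ i, |x i - n i| ≤ 1 / 2 := fun i => by
    have h := (AddCircle.equivIoc 1 (-(1 / 2)) (x i : UnitAddCircle)).2
    rw [hn i] at h
    exact abs_le.2 ⟨h.1.le, by linarith [h.2]⟩
  rw [UnitAddTorus.periodize]
  simp_rw [hn]
  by_cases hnm : n = m
  · rw [hnm]
  obtain ⟨i, hi⟩ := Function.ne_iff.1 hnm
  have h3 : (1 : ℝ) ≤ |(x i - m i) - (x i - n i)| := by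
    have : (1 : ℤ) ≤ |n i - m i| := Int.one_le_abs (sub_ne_zero.2 hi)
    have h : (x i - m i) - (x i - n i) = ((n i - m i : ℤ) : ℝ) := by
      push_cast
      ring
    rw [h]
    exact_mod_cast this
  have h4 := h3.trans (abs_sub _ _)
  have hz1 : k (fun i => x i - n i) = 0 := by
    by_contra h
    linarith [hk _ h i, hx i]
  have hz2 : k (fun i => x i - m i) = 0 := by
    by_contra h
    linarith [hk _ h i, h2 i]
  rw [hz1, hz2]

lemma UnitAddTorus.continuous_periodize {k : (ι → ℝ) → ℂ} (hc : Continuous k)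
    (hk : ∀ x, k x ≠ 0 → ∀ i, |x i| < 1 / 4) : Continuous (UnitAddTorus.periodize k) := by
  have hq : IsOpenQuotientMap (fun (x : ι → ℝ) (i : ι) => (x i : UnitAddCircle)) :=
    IsOpenQuotientMap.piMap fun _ => QuotientAddGroup.isOpenQuotientMap_mk
  rw [← hq.continuous_comp_iff, continuous_iff_continuousAt]
  intro x₀
  have hev : ∀ᶠ x : ι → ℝ in nhds x₀, ∀ i, |x i - round (x₀ i)| < 3 / 4 := by
    refine eventually_all.2 fun i => ?_
    have hcont : Continuous fun x : ι → ℝ => |x i - round (x₀ i)| := by fun_prop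
    exact hcont.continuousAt.eventually_lt_const
      ((abs_sub_round (x₀ i)).trans_lt (by norm_num))
  refine ContinuousAt.congr (f := fun x : ι → ℝ => k fun i => x i - round (x₀ i)) ?_
    (hev.mono fun x hx => (UnitAddTorus.periodize_coe_sub hk x _ hx).symm)
  exact (hc.comp (by fun_prop)).continuousAt

lemma UnitAddTorus.mFourierCoeff_periodize {k : (ι → ℝ) → ℂ}
    (hk : ∀ x, k x ≠ 0 → ∀ i, |x i| < 1 / 4) (n : ι → ℤ) :
    UnitAddTorus.mFourierCoeff (UnitAddTorus.periodize k) n =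
      ∫ x, Complex.exp (-(Complex.I * ((∑ i, (n i : ℝ) * (2 * Real.pi * x i) : ℝ) : ℂ))) * k x := by
  rw [UnitAddTorus.mFourierCoeff_eq_integral _ _ fun _ => -(1 / 2)]
  have hset : MeasurableSet {x : ι → ℝ | ∀ i, x i ∈ Set.Ioc (-(1 / 2) : ℝ) (-(1 / 2) + 1)} :=
    MeasurableSet.univ_pi' fun _ => measurableSet_Ioc
  refine Eq.trans ?_ (setIntegral_eq_integral_of_forall_compl_eq_zero
    (s := {x : ι → ℝ | ∀ i, x i ∈ Set.Ioc (-(1 / 2) : ℝ) (-(1 / 2) + 1)}) ?_)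
  · refine setIntegral_congr_fun hset fun x hx => ?_
    rw [UnitAddTorus.periodize_coe x hx, UnitAddTorus.mFourier_coe_apply, smul_eq_mul]
    congr 2
    simp
  · intro x hx
    rw [mul_eq_zero]
    by_contra h
    rw [not_or] at h
    refine hx fun i => ?_
    have h1 := abs_lt.1 (hk x h.2 i)
    exact ⟨by linarith [h1.1], by linarith [h1.2]⟩

lemma hasSum_fourier_unit_box {k : (ι → ℝ) → ℂ} (hc : Continuous k)
    (hk : ∀ x, k x ≠ 0 → ∀ i, |x i| < 1 / 4)
    (hs : Summable fun n : ι → ℤ => ∫ x, Complex.exp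
      (-(Complex.I * ((∑ i, (n i : ℝ) * (2 * Real.pi * x i) : ℝ) : ℂ))) * k x)
    {x : ι → ℝ} (hx : ∀ i, |x i| < 1 / 4) :
    HasSum (fun n : ι → ℤ => (∫ y, Complex.exp
      (-(Complex.I * ((∑ i, (n i : ℝ) * (2 * Real.pi * y i) : ℝ) : ℂ))) * k y) *
      Complex.exp (Complex.I * ((∑ i, (n i : ℝ) * (2 * Real.pi * x i) : ℝ) : ℂ))) (k x) := by
  simp_rw [← UnitAddTorus.mFourierCoeff_periodize hk] at hs ⊢
  have h := UnitAddTorus.hasSum_mFourier_series_apply_of_summable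
    (f := ⟨_, UnitAddTorus.continuous_periodize hc hk⟩) hs fun i => (x i : UnitAddCircle)
  simp only [ContinuousMap.coe_mk, smul_eq_mul, UnitAddTorus.mFourier_coe_apply] at h
  rwa [UnitAddTorus.periodize_coe x fun i => ?_] at h
  have h1 := abs_lt.1 (hx i)
  exact ⟨by linarith [h1.1], by linarith [h1.2]⟩

lemma hasSum_fourier_box {h : (ι → ℝ) → ℂ} (hc : Continuous h)
    (hh : ∀ x, h x ≠ 0 → ∀ i, |x i| < 1)
    (hs : Summable fun n : ι → ℤ => ∫ x, h x * Complex.exp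
      (-(Complex.I * ((∑ i, (n i : ℝ) * x i : ℝ) : ℂ))))
    {x : ι → ℝ} (hx : ∀ i, |x i| < 1) :
    HasSum (fun n : ι → ℤ => ((((2 * Real.pi) ^ Fintype.card ι)⁻¹ : ℝ) : ℂ) * (∫ y, h y *
      Complex.exp (-(Complex.I * ((∑ i, (n i : ℝ) * y i : ℝ) : ℂ)))) *
      Complex.exp (Complex.I * ((∑ i, (n i : ℝ) * x i : ℝ) : ℂ))) (h x) := by
  have hpi : (4 : ℝ) < 2 * Real.pi := by linarith [Real.pi_gt_three]
  have hpi0 : (0 : ℝ) < 2 * Real.pi := by linarith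
  have hint : ∀ n : ι → ℤ, (∫ y, Complex.exp
      (-(Complex.I * ((∑ i, (n i : ℝ) * (2 * Real.pi * y i) : ℝ) : ℂ))) *
        h ((2 * Real.pi) • y)) = ((((2 * Real.pi) ^ Fintype.card ι)⁻¹ : ℝ) : ℂ) * (∫ y, h y *
      Complex.exp (-(Complex.I * ((∑ i, (n i : ℝ) * y i : ℝ) : ℂ)))) := fun n => by
    have h1 := Measure.integral_comp_smul (volume : Measure (ι → ℝ)) (fun y => h y *
      Complex.exp (-(Complex.I * ((∑ i, (n i : ℝ) * y i : ℝ) : ℂ)))) (2 * Real.pi)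
    rw [Module.finrank_pi, abs_of_pos (by positivity), Complex.real_smul] at h1
    rw [← h1]
    congr 1
    ext y
    rw [mul_comm]
    rfl
  have hbox : ∀ y : ι → ℝ, (∀ i, |y i| < 1) → ∀ i, |((2 * Real.pi)⁻¹ • y) i| < 1 / 4 := by
    intro y hy i
    rw [Pi.smul_apply, smul_eq_mul, abs_mul, abs_of_pos (inv_pos.2 hpi0), inv_mul_lt_iff₀ hpi0]
    linarith [hy i]
  have hk : ∀ y, h ((2 * Real.pi) • y) ≠ 0 → ∀ i, |y i| < 1 / 4 := fun y hy => by
    have h1 := hbox _ (hh _ hy)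
    rwa [smul_smul, inv_mul_cancel₀ hpi0.ne', one_smul] at h1
  have hmain := hasSum_fourier_unit_box (k := fun y => h ((2 * Real.pi) • y)) (by fun_prop) hk
    (by simp_rw [hint]; exact hs.mul_left _) (hbox x hx)
  simp_rw [hint] at hmain
  have e1 : ∀ i, 2 * Real.pi * ((2 * Real.pi)⁻¹ • x) i = x i := fun i => by
    rw [Pi.smul_apply, smul_eq_mul, mul_inv_cancel_left₀ hpi0.ne']
  simp_rw [e1, smul_smul, mul_inv_cancel₀ hpi0.ne', one_smul] at hmain
  exact hmain

end FourierBox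

section FourierBoxProd

variable {d : ℕ}

/-- The frequency `(m₁, −m₂)` as an integer vector indexed by `Fin d ⊕ Fin d`. -/
def sumFrequency (d : ℕ) : Idx d ≃ (Fin d ⊕ Fin d → ℤ) :=
  ((Equiv.refl _).prodCongr (Equiv.neg _)).trans (Equiv.sumArrowEquivProdArrow _ _ _).symm

lemma sum_sumFrequency_mul (m : Idx d) (z : Fin d ⊕ Fin d → ℝ) :
    ∑ i, (sumFrequency d m i : ℝ) * z i =
      diffPairing d (intPoint d m) (fun i => z (.inl i), fun i => z (.inr i)) := by
  rw [Fintype.sum_sum_type, diffPairing, sub_eq_add_neg, ← Finset.sum_neg_distrib]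
  simp [sumFrequency, intPoint, Equiv.sumArrowEquivProdArrow]

lemma hasSum_fourier_box_prod {h : E2 d → ℂ} (hc : Continuous h)
    (hh : ∀ x, h x ≠ 0 → ∀ i, |x.1 i| < 1 ∧ |x.2 i| < 1)
    (hs : Summable fun m : Idx d => ∫ y, h y * Complex.exp
      (-(Complex.I * (diffPairing d (intPoint d m) y : ℂ))))
    {x : E2 d} (hx : ∀ i, |x.1 i| < 1 ∧ |x.2 i| < 1) :
    HasSum (fun m : Idx d => ((((2 * Real.pi) ^ (2 * d))⁻¹ : ℝ) : ℂ) * (∫ y, h y *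
      Complex.exp (-(Complex.I * (diffPairing d (intPoint d m) y : ℂ)))) *
      Complex.exp (Complex.I * (diffPairing d (intPoint d m) x : ℂ))) (h x) := by
  have hint : ∀ m : Idx d, ∫ y, h y * Complex.exp
      (-(Complex.I * (diffPairing d (intPoint d m) y : ℂ))) =
      ∫ z : Fin d ⊕ Fin d → ℝ, h (fun i => z (.inl i), fun i => z (.inr i)) * Complex.exp
        (-(Complex.I * ((∑ i, (sumFrequency d m i : ℝ) * z i : ℝ) : ℂ))) := fun m => by
    simp_rw [sum_sumFrequency_mul]
    exact ((volume_measurePreserving_sumPiEquivProdPi fun _ : Fin d ⊕ Fin d => ℝ).integral_comp'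
      (fun y : E2 d => h y * Complex.exp
        (-(Complex.I * (diffPairing d (intPoint d m) y : ℂ))))).symm
  simp_rw [hint] at hs ⊢
  have h1 := hasSum_fourier_box
    (h := fun z : Fin d ⊕ Fin d → ℝ => h (fun i => z (.inl i), fun i => z (.inr i)))
    (by fun_prop) (fun z hz i => by
      cases i with
      | inl i => exact (hh _ hz i).1
      | inr i => exact (hh _ hz i).2) ((sumFrequency d).summable_iff.1 hs)
    (x := Sum.elim x.1 x.2) (by
      rintro (i | i)
      exacts [(hx i).1, (hx i).2])
  have h2 := (sumFrequency d).hasSum_iff.2 h1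
  simp only [Function.comp_def, Sum.elim_inl, Sum.elim_inr, Fintype.card_sum, Fintype.card_fin,
    ← two_mul, sum_sumFrequency_mul _ (Sum.elim x.1 x.2)] at h2
  exact h2

end FourierBoxProd

section Reconstruction

variable {d : ℕ} {B : Fin d → Fin d → (Fin d → ℝ) → ℝ} {g : E1 d → ℝ}

lemma gaborWindow_mul_conj (p : E2 d) :
    gaborWindow d B g p * (starRingEnd ℂ) (gaborWindow d B g p) =
      ((g (p.1 - p.2) ^ 2 : ℝ) : ℂ) := by
  rw [gaborWindow, map_mul, Complex.conj_exp_I_mul_ofReal, Complex.conj_ofReal,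
    mul_mul_mul_comm, ← Complex.exp_add, add_neg_cancel, Complex.exp_zero, one_mul, pow_two,
    Complex.ofReal_mul]

lemma gaborWindowTensor_mul_conj (p A : E2 d) :
    gaborWindowTensor d B g (p, A) * (starRingEnd ℂ) (gaborWindowTensor d B g (p, A)) =
      ((g (p.1 - A.1) ^ 2 * g (p.2 - A.2) ^ 2 : ℝ) : ℂ) := by
  rw [gaborWindowTensor, map_mul, mul_mul_mul_comm, ← map_mul, gaborWindow_mul_conj,
    gaborWindow_mul_conj, Complex.conj_ofReal, ← Complex.ofReal_mul]

lemma IsWindow.abs_sub_lt_of_gaborWindowTensor_ne_zero (hg : IsWindow d g) {p A : E2 d}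
    (h : gaborWindowTensor d B g (p, A) ≠ 0) (i : Fin d) :
    |(p - A).1 i| < 1 ∧ |(p - A).2 i| < 1 := by
  rw [gaborWindowTensor, mul_ne_zero_iff] at h
  refine ⟨hg.support_subset _ (fun h0 => h.1 ?_) i, hg.support_subset _ (fun h0 => h.2 ?_) i⟩
  · rw [Prod.fst_sub] at h0
    simp [gaborWindow, h0]
  · rw [Prod.snd_sub] at h0
    simp [gaborWindow, h0]

lemma frameCoef_eq_integral_shift (a b : Idx d) (F : E2 d → ℂ) :
    frameCoef d B g a b F = gaborConst d ^ 2 * ∫ p : E2 d,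
      F (p + intPoint d (a.1, b.1)) * (starRingEnd ℂ)
        (gaborWindowTensor d B g (p + intPoint d (a.1, b.1), intPoint d (a.1, b.1))) *
      Complex.exp (-(Complex.I * (diffPairing d (intPoint d (a.2, b.2)) p : ℂ))) := by
  rw [frameCoef_eq, ← integral_add_right_eq_self (μ := volume) _ (intPoint d (a.1, b.1))]
  simp_rw [add_sub_cancel_right]

lemma summable_frameCoef_frequency (hd : 0 < d) (hB : IsRegularMagneticField d B)
    (hg : IsWindow d g) (F : SchwartzMap (E2 d) ℂ) (A : Idx d) :
    Summable fun m : Idx d => frameCoef d B g (A.1, m.1) (A.2, m.2) F := by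
  obtain ⟨R, hR⟩ := exists_summable_one_add_norm_pow_inv_prod
    (exists_summable_one_add_norm_pow_inv_pi d) (exists_summable_one_add_norm_pow_inv_pi d)
  obtain ⟨C, hC, hN⟩ := exists_norm_frameCoef_le hd hB hg F R
  refine Summable.of_norm_bounded (hR.mul_left C) fun m => ?_
  rw [← div_eq_mul_inv, le_div_iff₀ (by positivity), mul_comm]
  refine le_trans ?_ (hN (A.1, m.1) (A.2, m.2))
  gcongr
  exact le_mul_of_one_le_left (by positivity) (le_add_of_nonneg_right (norm_nonneg _))

lemma hasSum_frameCoef_mul_gaborTensor_frequency (hd : 0 < d) (hB : IsRegularMagneticField d B)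
    (hg : IsWindow d g) (F : SchwartzMap (E2 d) ℂ) (A : Idx d) (X : E2 d) :
    HasSum (fun m : Idx d => frameCoef d B g (A.1, m.1) (A.2, m.2) F *
      gaborTensor d B g (A.1, m.1) (A.2, m.2) X)
      (F X * ((g (X.1 - (intPoint d A).1) ^ 2 * g (X.2 - (intPoint d A).2) ^ 2 : ℝ) : ℂ)) := by
  rw [← gaborWindowTensor_mul_conj (B := B)]
  by_cases hX : gaborWindowTensor d B g (X, intPoint d A) = 0
  · simp_rw [gaborTensor_eq, hX]
    simp
  have hpi : (0 : ℝ) < 2 * Real.pi := by positivity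
  have hc0 : gaborConst d ^ 2 ≠ 0 := by
    intro h0
    have h1 := gaborConst_pow_four d
    rw [show gaborConst d ^ 4 = (gaborConst d ^ 2) ^ 2 by ring, h0, zero_pow two_ne_zero] at h1
    exact (inv_pos.2 (pow_pos hpi (2 * d))).ne (by exact_mod_cast h1)
  set h : E2 d → ℂ := fun p => F (p + intPoint d A) * (starRingEnd ℂ)
    (gaborWindowTensor d B g (p + intPoint d A, intPoint d A)) with hh
  have hcont : Continuous h := by
    have h1 := (hasTemperateGrowth_conj_gaborWindowTensor hB hg).1.continuous
    exact (F.continuous.comp (by fun_prop)).mul (h1.comp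
      (f := fun p : E2 d => (p + intPoint d A, intPoint d A)) (by fun_prop))
  have hsupp : ∀ x, h x ≠ 0 → ∀ i, |x.1 i| < 1 ∧ |x.2 i| < 1 := fun x hx i => by
    have h1 := hg.abs_sub_lt_of_gaborWindowTensor_ne_zero (B := B) (p := x + intPoint d A)
      (A := intPoint d A) (fun h0 => hx (by simp [hh, h0])) i
    rwa [add_sub_cancel_right] at h1
  have hco : ∀ m : Idx d, frameCoef d B g (A.1, m.1) (A.2, m.2) F = gaborConst d ^ 2 *
      ∫ p, h p * Complex.exp (-(Complex.I * (diffPairing d (intPoint d m) p : ℂ))) :=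
    fun m => frameCoef_eq_integral_shift (A.1, m.1) (A.2, m.2) F
  have hs := summable_frameCoef_frequency hd hB hg F A
  simp_rw [hco, summable_mul_left_iff hc0] at hs
  have hmain := (hasSum_fourier_box_prod hcont hsupp hs
    (hg.abs_sub_lt_of_gaborWindowTensor_ne_zero hX)).mul_right
      (gaborWindowTensor d B g (X, intPoint d A))
  have hval : h (X - intPoint d A) * gaborWindowTensor d B g (X, intPoint d A) =
      F X * (gaborWindowTensor d B g (X, intPoint d A) *
        (starRingEnd ℂ) (gaborWindowTensor d B g (X, intPoint d A))) := by
    simp only [hh, sub_add_cancel]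
    ring
  rw [hval] at hmain
  refine hmain.congr_fun fun m => ?_
  rw [hco, gaborTensor_eq, ← gaborConst_pow_four]
  ring

lemma IsWindow.hasSum_sq (hg : IsWindow d g) (x : E1 d) :
    HasSum (fun α : Fin d → ℤ => g (x - fun i => (α i : ℝ)) ^ 2) 1 := by
  have h : Summable fun α : Fin d → ℤ => g (x - fun i => (α i : ℝ)) ^ 2 := by
    by_contra h
    exact zero_ne_one ((tsum_eq_zero_of_not_summable h).symm.trans (hg.partition x))
  exact hg.partition x ▸ h.hasSum

lemma IsWindow.hasSum_sq_mul_sq (hg : IsWindow d g) (X : E2 d) :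
    HasSum (fun A : Idx d =>
      g (X.1 - (intPoint d A).1) ^ 2 * g (X.2 - (intPoint d A).2) ^ 2) 1 := by
  have h1 := hg.hasSum_sq X.1
  have h2 := hg.hasSum_sq X.2
  have h := h1.mul h2 (h1.summable.mul_of_nonneg h2.summable (fun _ => sq_nonneg _)
    fun _ => sq_nonneg _)
  rwa [one_mul] at h

lemma hasSum_frameCoef_mul_gaborTensor (hd : 0 < d) (hB : IsRegularMagneticField d B)
    (hg : IsWindow d g) (F : SchwartzMap (E2 d) ℂ) (X : E2 d)
    (hs : Summable fun q : Idx2 d => frameCoef d B g q.1 q.2 F * gaborTensor d B g q.1 q.2 X) :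
    HasSum (fun q : Idx2 d => frameCoef d B g q.1 q.2 F * gaborTensor d B g q.1 q.2 X) (F X) := by
  rw [← (Equiv.prodProdProdComm (Fin d → ℤ) (Fin d → ℤ) (Fin d → ℤ)
    (Fin d → ℤ)).summable_iff] at hs
  have h1 := hs.hasSum.prod_fiberwise fun A =>
    hasSum_frameCoef_mul_gaborTensor_frequency hd hB hg F A X
  have h2 := (hg.hasSum_sq_mul_sq X).mapL Complex.ofRealCLM |>.mul_left (F X)
  simp only [Complex.ofRealCLM_apply, Complex.ofReal_one, mul_one] at h2
  rw [← (Equiv.prodProdProdComm (Fin d → ℤ) (Fin d → ℤ) (Fin d → ℤ)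
    (Fin d → ℤ)).hasSum_iff, ← h1.unique h2]
  exact hs.hasSum

end Reconstruction

/-- for Schwartz `F` the frame expansion converges to `F` in the Schwartz
topology. -/
theorem statement12 (d : ℕ) (hd : 0 < d) (B : Fin d → Fin d → (Fin d → ℝ) → ℝ)
    (hB : IsRegularMagneticField d B) (g : (Fin d → ℝ) → ℝ) (hg : IsWindow d g)
    (F : SchwartzMap (E2 d) ℂ)
    (GT : Idx2 d → SchwartzMap (E2 d) ℂ)
    (hGT : ∀ q : Idx2 d, ⇑(GT q) = gaborTensor d B g q.1 q.2) :
    HasSum (fun q : Idx2 d => frameCoef d B g q.1 q.2 ⇑F • GT q) F := by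
  have hs := summable_norm_frameCoef_mul_seminorm hd hB hg F GT hGT
  have hval : ∀ (q : Idx2 d) (X : E2 d), (frameCoef d B g q.1 q.2 F • GT q) X =
      frameCoef d B g q.1 q.2 F * gaborTensor d B g q.1 q.2 X := fun q X => by
    rw [_root_.smul_apply, hGT, smul_eq_mul]
  refine SchwartzMap.hasSum_of_summable_seminorm hs fun X => ?_
  simp_rw [hval]
  refine hasSum_frameCoef_mul_gaborTensor hd hB hg F X
    (Summable.of_norm_bounded (hs 0 0) fun q => ?_)
  rw [← hval]
  exact SchwartzMap.norm_le_seminorm ℝ _ X
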